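/- Let X be a set, let z_1, …, z_N be latent points mapped by a generator G into X and let x_1, …, x_M be true data points in X. Let δ^N_G = (1/N) Σ_{i=1}^N δ_{G(z_i)} and δ^M_r = (1/M) Σ_{j=1}^M δ_{x_j} be the corresponding empirical probability measures on X. Then the optimal discriminator value J(G) := sup over D : X → (0,1) of [(1/M) Σ_j log D(x_j) + (1/N) Σ_i log(1 − D(G(z_i)))] satisfies J(G) = −log 4 + 2·JS(δ^M_r, δ^N_G); in particular J(G) ≥ −log 4, with equality if and only if δ^N_G = δ^M_r. -/

import Mathlib

open MeasureTheory
open scoped ENNReal Classical BigOperators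

/-- Kullback–Leibler divergence `KL(P‖Q) = ∫ log (dP/dQ) dP`, equal to `+∞` if `P` is not
absolutely continuous with respect to `Q` (or if the log-likelihood ratio fails to be
integrable). -/
noncomputable def klDiv {X : Type*} [MeasurableSpace X] (P Q : Measure X) : EReal :=
  if P ≪ Q ∧ Integrable (llr P Q) P then ((∫ x, llr P Q x ∂P : ℝ) : EReal) else ⊤

/-- Jensen–Shannon divergence `JS(P,Q) = ½ KL(P ‖ ½(P+Q)) + ½ KL(Q ‖ ½(P+Q))`. -/
noncomputable def jsDiv {X : Type*} [MeasurableSpace X] (P Q : Measure X) : EReal :=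
  ((1 / 2 : ℝ) : EReal) * klDiv P ((2 : ℝ≥0∞)⁻¹ • (P + Q))
    + ((1 / 2 : ℝ) : EReal) * klDiv Q ((2 : ℝ≥0∞)⁻¹ • (P + Q))

/-- Tangent-line bound at the maximiser `a / (a + b)` of the discriminator functional. -/
lemma mul_log_le_mul_log_div_add {a b d : ℝ} (ha : 0 ≤ a) (hb : 0 ≤ b) (hd : 0 < d) :
    a * Real.log d ≤ a * Real.log (a / (a + b)) + (d * (a + b) - a) := by
  rcases ha.eq_or_lt with rfl | ha
  · simp only [zero_mul, zero_add, sub_zero]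
    positivity
  · have hab : 0 < a + b := by positivity
    have h := Real.log_le_sub_one_of_pos (x := d / (a / (a + b))) (by positivity)
    rw [Real.log_div hd.ne' (by positivity)] at h
    have h2 := mul_le_mul_of_nonneg_left h ha.le
    have h3 : a * (d / (a / (a + b)) - 1) = d * (a + b) - a := by field_simp
    linarith

lemma half_sub_le_mul_log {a b : ℝ} (ha : 0 ≤ a) (hb : 0 ≤ b) :
    (a - b) / 2 ≤ a * Real.log (2 * a / (a + b)) := by
  rcases ha.eq_or_lt with rfl | ha
  · simp only [zero_mul]
    linarith
  · have hab : 0 < a + b := by positivity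
    have h := Real.one_sub_inv_le_log_of_pos (x := 2 * a / (a + b)) (by positivity)
    have h2 := mul_le_mul_of_nonneg_left h ha.le
    have h3 : a * (1 - (2 * a / (a + b))⁻¹) = (a - b) / 2 := by
      field_simp
      ring
    linarith

lemma half_sub_lt_mul_log {a b : ℝ} (ha : 0 ≤ a) (hb : 0 ≤ b) (hne : a ≠ b) :
    (a - b) / 2 < a * Real.log (2 * a / (a + b)) := by
  rcases ha.eq_or_lt with rfl | ha
  · have : 0 < b := lt_of_le_of_ne hb hne
    simp only [zero_mul]
    linarith
  · have hab : 0 < a + b := by positivity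
    have hx : ((a + b) / (2 * a)) ≠ 1 := by
      intro h
      rw [div_eq_one_iff_eq (by positivity)] at h
      exact hne (by linarith)
    have h := Real.log_lt_sub_one_of_pos (x := (a + b) / (2 * a)) (by positivity) hx
    rw [← inv_div, Real.log_inv] at h
    have h2 := mul_lt_mul_of_pos_left h ha
    have h3 : a * ((2 * a / (a + b))⁻¹ - 1) = (b - a) / 2 := by
      field_simp
      ring
    linarith

open Filter Topology in
/-- The optimal value of the discriminator functional for finitely many nonnegative weights. -/
lemma isLUB_discriminator {X : Type*} (S : Finset X) {a b : X → ℝ} (ha : ∀ x, 0 ≤ a x)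
    (hb : ∀ x, 0 ≤ b x) :
    IsLUB (Set.range fun D : {D : X → ℝ // ∀ x, D x ∈ Set.Ioo (0 : ℝ) 1} =>
        ∑ x ∈ S, a x * Real.log (D.1 x) + ∑ x ∈ S, b x * Real.log (1 - D.1 x))
      (∑ x ∈ S, a x * Real.log (a x / (a x + b x))
        + ∑ x ∈ S, b x * Real.log (b x / (b x + a x))) := by
  have key : ∀ {u v : ℝ}, 0 ≤ u → 0 ≤ v →
      Tendsto (fun ε : ℝ => u * Real.log ((u + ε) / (u + v + 2 * ε))) (𝓝[>] 0)
        (𝓝 (u * Real.log (u / (u + v)))) := by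
    intro u v hu hv
    rcases hu.eq_or_lt with rfl | hu
    · simp
    · have hc : ContinuousAt (fun ε : ℝ => u * Real.log ((u + ε) / (u + v + 2 * ε))) 0 := by
        refine continuousAt_const.mul (ContinuousAt.log (ContinuousAt.div ?_ ?_ ?_) ?_)
        · fun_prop
        · fun_prop
        · simp only [mul_zero, add_zero]; positivity
        · simp only [mul_zero, add_zero]; positivity
      simpa using hc.tendsto.mono_left nhdsWithin_le_nhds
  constructor
  · rintro _ ⟨D, rfl⟩
    simp only [← Finset.sum_add_distrib]
    refine Finset.sum_le_sum fun x _ => ?_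
    have h1 := mul_log_le_mul_log_div_add (ha x) (hb x) (D.2 x).1
    have h2 := mul_log_le_mul_log_div_add (hb x) (ha x) (sub_pos.2 (D.2 x).2)
    linarith
  · intro c hc
    have hlim := (tendsto_finsetSum S fun x _ => key (ha x) (hb x)).add
      (tendsto_finsetSum S fun x _ => key (hb x) (ha x))
    refine le_of_tendsto hlim ?_
    filter_upwards [self_mem_nhdsWithin] with ε hε
    have hε : 0 < ε := hε
    have hpos : ∀ x, 0 < a x + b x + 2 * ε := fun x => by
      have := ha x
      have := hb x
      positivity
    refine le_trans (le_of_eq ?_) (hc ⟨⟨fun x => (a x + ε) / (a x + b x + 2 * ε), fun x =>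
      ⟨div_pos (by linarith [ha x]) (hpos x), (div_lt_one (hpos x)).2 (by linarith [hb x])⟩⟩, rfl⟩)
    congr 1
    refine Finset.sum_congr rfl fun x _ => ?_
    congr 2
    have h1 := (hpos x).ne'
    have h2 : b x + a x + 2 * ε ≠ 0 := by rwa [add_comm (b x)]
    rw [add_comm (b x) (a x), eq_sub_iff_add_eq, ← add_div, div_eq_one_iff_eq h1]
    ring

lemma integral_eq_sum_of_compl_null {X : Type*} [MeasurableSpace X] [MeasurableSingletonClass X]
    {P : Measure X} [IsFiniteMeasure P] {S : Finset X} (hS : P (S : Set X)ᶜ = 0) (f : X → ℝ) :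
    Integrable f P ∧ ∫ x, f x ∂P = ∑ x ∈ S, P.real {x} * f x := by
  have hr : P.restrict (S : Set X) = P := Measure.restrict_eq_self_of_ae_mem hS
  have hi : IntegrableOn f (S : Set X) P := IntegrableOn.finset
  constructor
  · rwa [IntegrableOn, hr] at hi
  · have h := setIntegral_finset S hi
    rw [hr] at h
    simpa using h

lemma rnDeriv_mul_singleton {X : Type*} [MeasurableSpace X] [MeasurableSingletonClass X]
    {P m : Measure X} [IsFiniteMeasure P] [IsFiniteMeasure m] (h : P ≪ m) (x : X) :
    P.rnDeriv m x * m {x} = P {x} := by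
  rw [← lintegral_singleton, ← withDensity_apply _ (measurableSet_singleton x),
    Measure.withDensity_rnDeriv_eq _ _ h]

lemma klDiv_half_add {X : Type*} [MeasurableSpace X] [MeasurableSingletonClass X]
    {P Q : Measure X} [IsFiniteMeasure P] [IsFiniteMeasure Q] {S : Finset X}
    (hS : P (S : Set X)ᶜ = 0) :
    klDiv P ((2 : ℝ≥0∞)⁻¹ • (P + Q)) =
      ((∑ x ∈ S, P.real {x} * Real.log (2 * P.real {x} / (P.real {x} + Q.real {x})) : ℝ) :
        EReal) := by
  have hac : P ≪ (2 : ℝ≥0∞)⁻¹ • (P + Q) :=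
    (Measure.AbsolutelyContinuous.rfl.add_right Q).trans
      (Measure.absolutelyContinuous_smul (by simp))
  have : IsFiniteMeasure ((2 : ℝ≥0∞)⁻¹ • (P + Q)) := Measure.smul_finite _ (by simp)
  obtain ⟨hi, he⟩ := integral_eq_sum_of_compl_null hS (llr P ((2 : ℝ≥0∞)⁻¹ • (P + Q)))
  rw [klDiv, if_pos ⟨hac, hi⟩, he]
  congr 1
  refine Finset.sum_congr rfl fun x _ => ?_
  by_cases hx : P.real {x} = 0
  · simp [hx]
  congr 2
  have hd := congrArg ENNReal.toReal (rnDeriv_mul_singleton hac x)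
  have hpos : 0 < P.real {x} := lt_of_le_of_ne measureReal_nonneg (Ne.symm hx)
  have hq : 0 ≤ Q.real {x} := measureReal_nonneg
  have hm : (((2 : ℝ≥0∞)⁻¹ • (P + Q)) {x}).toReal = (P.real {x} + Q.real {x}) / 2 := by
    simp only [Measure.smul_apply, Measure.add_apply, smul_eq_mul, ENNReal.toReal_mul,
      ENNReal.toReal_inv, ENNReal.toReal_ofNat]
    rw [ENNReal.toReal_add (measure_ne_top _ _) (measure_ne_top _ _)]
    simp only [measureReal_def]
    ring
  rw [ENNReal.toReal_mul, hm, ← measureReal_def] at hd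
  rw [llr]
  congr 1
  rw [eq_div_iff (by positivity)]
  linarith

lemma ext_of_singleton_of_compl_null {X : Type*} [MeasurableSpace X] [MeasurableSingletonClass X]
    {P Q : Measure X} [IsFiniteMeasure P] [IsFiniteMeasure Q] {S : Finset X}
    (hP : P (S : Set X)ᶜ = 0) (hQ : Q (S : Set X)ᶜ = 0)
    (h : ∀ x ∈ S, P.real {x} = Q.real {x}) : P = Q := by
  refine Measure.ext fun A hA => ?_
  rw [← measureReal_eq_measureReal_iff, ← integral_indicator_one hA, ← integral_indicator_one hA,
    (integral_eq_sum_of_compl_null hP _).2, (integral_eq_sum_of_compl_null hQ _).2]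
  exact Finset.sum_congr rfl fun x hx => by rw [h x hx]

lemma empirical_properties {X : Type*} [MeasurableSpace X] [MeasurableSingletonClass X]
    {n : ℕ} (hn : 0 < n) (f : Fin n → X) :
    IsProbabilityMeasure ((n : ℝ≥0∞)⁻¹ • ∑ i, Measure.dirac (f i)) ∧
    (∀ S : Finset X, Finset.univ.image f ⊆ S →
      ((n : ℝ≥0∞)⁻¹ • ∑ i, Measure.dirac (f i)) (S : Set X)ᶜ = 0) ∧
    ∀ h : X → ℝ, ∫ x, h x ∂((n : ℝ≥0∞)⁻¹ • ∑ i, Measure.dirac (f i)) =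
      (1 / n : ℝ) * ∑ i, h (f i) := by
  refine ⟨⟨?_⟩, fun S hS => ?_, fun h => ?_⟩
  · simp only [Measure.smul_apply, Measure.finsetSum_apply, measure_univ, Finset.sum_const,
      Finset.card_univ, Fintype.card_fin, nsmul_eq_mul, mul_one, smul_eq_mul]
    exact ENNReal.inv_mul_cancel (by exact_mod_cast hn.ne') (by simp)
  · simp only [Measure.smul_apply, Measure.finsetSum_apply, smul_eq_mul, mul_eq_zero]
    refine Or.inr (Finset.sum_eq_zero fun i _ => ?_)
    have : f i ∈ S := hS (Finset.mem_image_of_mem f (Finset.mem_univ i))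
    rw [Measure.dirac_apply]
    simp [this]
  · rw [integral_smul_measure, integral_finsetSum_measure]
    · simp
    · exact fun i _ => integrable_dirac (by simp)

/-- For latent points mapped by `G` to `G(z_1), …, G(z_N)` and true data `x_1, …, x_M`,
with empirical measures `δ^N_G = (1/N) Σ_i δ_{G(z_i)}` and `δ^M_r = (1/M) Σ_j δ_{x_j}`,
the optimal discriminator value
`J(G) = sup_{D : X → (0,1)} [(1/M) Σ_j log D(x_j) + (1/N) Σ_i log (1 - D(G(z_i)))]`
satisfies `J(G) = - log 4 + 2 JS(δ^M_r, δ^N_G)`; in particular `J(G) ≥ - log 4`, with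
equality iff `δ^N_G = δ^M_r`. -/
theorem stmt6 {X : Type*} [MeasurableSpace X] [MeasurableSingletonClass X]
    {N M : ℕ} (hN : 0 < N) (hM : 0 < M) (g : Fin N → X) (xs : Fin M → X) :
    let μG : Measure X := (N : ℝ≥0∞)⁻¹ • ∑ i, Measure.dirac (g i)
    let μr : Measure X := (M : ℝ≥0∞)⁻¹ • ∑ j, Measure.dirac (xs j)
    let J : ℝ := ⨆ D : {D : X → ℝ // ∀ x, D x ∈ Set.Ioo (0 : ℝ) 1},
      ((1 / M : ℝ) * ∑ j, Real.log (D.1 (xs j))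
        + (1 / N : ℝ) * ∑ i, Real.log (1 - D.1 (g i)))
    ((J : ℝ) : EReal) = ((-Real.log 4 : ℝ) : EReal) + 2 * jsDiv μr μG ∧
      -Real.log 4 ≤ J ∧ (J = -Real.log 4 ↔ μG = μr) := by
  intro μG μr J
  obtain ⟨hGp, hGS, hGi⟩ := empirical_properties hN g
  obtain ⟨hrp, hrS, hri⟩ := empirical_properties hM xs
  change IsProbabilityMeasure μG at hGp
  change IsProbabilityMeasure μr at hrp
  set S : Finset X := Finset.univ.image xs ∪ Finset.univ.image g
  have hG0 : μG (S : Set X)ᶜ = 0 := hGS S Finset.subset_union_right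
  have hr0 : μr (S : Set X)ᶜ = 0 := hrS S Finset.subset_union_left
  have hGsum (h : X → ℝ) : (1 / N : ℝ) * ∑ i, h (g i) = ∑ x ∈ S, μG.real {x} * h x := by
    rw [← hGi, (integral_eq_sum_of_compl_null hG0 h).2]
  have hrsum (h : X → ℝ) : (1 / M : ℝ) * ∑ j, h (xs j) = ∑ x ∈ S, μr.real {x} * h x := by
    rw [← hri, (integral_eq_sum_of_compl_null hr0 h).2]
  have hG1 : ∑ x ∈ S, μG.real {x} = 1 := by
    have h := (integral_eq_sum_of_compl_null hG0 fun _ => 1).2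
    simpa using h.symm
  have hr1 : ∑ x ∈ S, μr.real {x} = 1 := by
    have h := (integral_eq_sum_of_compl_null hr0 fun _ => 1).2
    simpa using h.symm
  set a : X → ℝ := fun x => μr.real {x}
  set b : X → ℝ := fun x => μG.real {x}
  have ha : ∀ x, 0 ≤ a x := fun x => measureReal_nonneg
  have hb : ∀ x, 0 ≤ b x := fun x => measureReal_nonneg
  have hJ : J = ∑ x ∈ S, a x * Real.log (a x / (a x + b x))
        + ∑ x ∈ S, b x * Real.log (b x / (b x + a x)) := by
    have : Nonempty {D : X → ℝ // ∀ x, D x ∈ Set.Ioo (0 : ℝ) 1} :=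
      ⟨⟨fun _ => 1 / 2, fun _ => by norm_num⟩⟩
    rw [← (isLUB_discriminator S ha hb).ciSup_eq]
    refine iSup_congr fun D => ?_
    rw [hrsum fun x => Real.log (D.1 x), hGsum fun x => Real.log (1 - D.1 x)]
  have hlog {u v : X → ℝ} (hu : ∀ x, 0 ≤ u x) (hv : ∀ x, 0 ≤ v x) (h1 : ∑ x ∈ S, u x = 1) :
      ∑ x ∈ S, u x * Real.log (u x / (u x + v x)) =
        -Real.log 2 + ∑ x ∈ S, u x * Real.log (2 * u x / (u x + v x)) := by
    have h2 : -Real.log 2 = ∑ x ∈ S, u x * -Real.log 2 := by rw [← Finset.sum_mul, h1, one_mul]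
    rw [h2, ← Finset.sum_add_distrib]
    refine Finset.sum_congr rfl fun x _ => ?_
    rcases (hu x).eq_or_lt with h0 | h0
    · simp [← h0]
    · have : 0 < u x + v x := add_pos_of_pos_of_nonneg h0 (hv x)
      rw [mul_div_assoc, Real.log_mul two_ne_zero (by positivity)]
      ring
  have h4 : Real.log 4 = 2 * Real.log 2 := by
    rw [show (4 : ℝ) = 2 ^ 2 by norm_num, Real.log_pow]
    norm_num
  have hJ' : J = -Real.log 4 + (∑ x ∈ S, a x * Real.log (2 * a x / (a x + b x))
        + ∑ x ∈ S, b x * Real.log (2 * b x / (b x + a x))) := by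
    rw [hJ, hlog ha hb hr1, hlog hb ha hG1, h4]
    ring
  have hnonneg : ∀ x ∈ S, 0 ≤ a x * Real.log (2 * a x / (a x + b x))
      + b x * Real.log (2 * b x / (b x + a x)) := fun x _ => by
    linarith [half_sub_le_mul_log (ha x) (hb x), half_sub_le_mul_log (hb x) (ha x)]
  refine ⟨?_, ?_, fun h => ?_, fun h => ?_⟩
  · rw [hJ', jsDiv, klDiv_half_add hr0, add_comm μr μG, klDiv_half_add hG0,
      show (2 : EReal) = ((2 : ℝ) : EReal) from rfl]
    norm_cast
    congr 1
    ring
  · rw [hJ', ← Finset.sum_add_distrib]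
    linarith [Finset.sum_nonneg hnonneg]
  · rw [hJ', ← Finset.sum_add_distrib, add_eq_left, Finset.sum_eq_zero_iff_of_nonneg hnonneg] at h
    refine ext_of_singleton_of_compl_null hG0 hr0 fun x hx => ?_
    by_contra hne
    linarith [h x hx, half_sub_lt_mul_log (ha x) (hb x) (Ne.symm hne),
      half_sub_lt_mul_log (hb x) (ha x) hne]
  · have hab : b = a := by simp only [a, b, h]
    have hz : ∑ x ∈ S, a x * Real.log (2 * a x / (a x + a x)) = 0 := by
      refine Finset.sum_eq_zero fun x _ => ?_
      by_cases h0 : a x = 0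
      · simp [h0]
      · rw [← two_mul, div_self (by positivity), Real.log_one, mul_zero]
    rw [hJ', hab, hz]
    ring
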